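/- arXiv:0807.2726 — 4 statements merged into one kernel-verified Lean document; each statement's English description precedes it below -/
import Mathlib

section
/- For all integers m ≥ 1 and n ≥ 4, m·log( Γ(n + m/2)·Γ(1/2) / ( Γ(m/2)·Γ(n + 1/2) ) ) ≤ (m(m−1)/2)·log n + max{ 0, log m − m·( log( Γ(m/2)/Γ(1/2) ) − m(m−1)/(4n) + 1/(12n) ) }. -/
open Real


lemma aux_log (n : ℕ) (hn : 4 ≤ n) (t : ℝ) (ht : 0 ≤ t) :
    Real.log ((n : ℝ) + t) ≤ Real.log n + t / n := by
  have hn0 : (0 : ℝ) < n := by exact_mod_cast (by omega : 0 < n)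
  have h1 : (n : ℝ) + t = n * (1 + t / n) := by field_simp
  have h2 : 0 < 1 + t / n := by positivity
  rw [h1, Real.log_mul hn0.ne' h2.ne']
  have := Real.log_le_sub_one_of_pos h2
  linarith

lemma aux_step (x : ℝ) (hx : 0 < x) :
    Real.log (Real.Gamma (x + 1)) = Real.log x + Real.log (Real.Gamma x) := by
  rw [Real.Gamma_add_one hx.ne', Real.log_mul hx.ne' (Real.Gamma_pos_of_pos hx).ne']

lemma aux_half (n : ℕ) (hn : 4 ≤ n) :
    Real.log (Real.Gamma ((n : ℝ) + 1)) - Real.log (Real.Gamma ((n : ℝ) + 1 / 2)) ≤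
      1 / 2 * Real.log n + 1 / (4 * n) := by
  have hn0 : (0 : ℝ) < n := by exact_mod_cast (by omega : 0 < n)
  have m1 : (n : ℝ) + 1 / 2 ∈ Set.Ioi (0 : ℝ) := by simp only [Set.mem_Ioi]; positivity
  have m2 : (n : ℝ) + 1 / 2 + 1 ∈ Set.Ioi (0 : ℝ) := by simp only [Set.mem_Ioi]; positivity
  have hc := Real.convexOn_log_Gamma.2 m1 m2 (show (0 : ℝ) ≤ 1 / 2 by norm_num)
    (show (0 : ℝ) ≤ 1 / 2 by norm_num) (by norm_num)
  simp only [Function.comp, smul_eq_mul] at hc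
  rw [aux_step _ (by positivity),
    show (1 / 2 * ((n : ℝ) + 1 / 2) + 1 / 2 * ((n : ℝ) + 1 / 2 + 1)) = n + 1 by ring] at hc
  have h2 := aux_log n hn (1 / 2) (by norm_num)
  have h3 : (1 : ℝ) / (4 * n) = 1 / 2 * (1 / 2 / n) := by field_simp; norm_num
  rw [h3]
  linarith

lemma aux_main (n : ℕ) (hn : 4 ≤ n) (k : ℕ) :
    Real.log (Real.Gamma ((n : ℝ) + ((k : ℝ) + 2) / 2)) -
      Real.log (Real.Gamma ((n : ℝ) + 1 / 2)) ≤
      ((k : ℝ) + 1) / 2 * Real.log n + (((k : ℝ) + 2) * (k + 1) / 4 - 1 / 12) * (1 / n) := by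
  have hn0 : (0 : ℝ) < n := by exact_mod_cast (by omega : 0 < n)
  have hi : (0 : ℝ) < 1 / n := by positivity
  induction k using Nat.twoStepInduction with
  | zero =>
    have h := aux_half n hn
    rw [show (1 : ℝ) / (4 * n) = 1 / 4 * (1 / n) by field_simp] at h
    rw [show (n : ℝ) + (((0 : ℕ) : ℝ) + 2) / 2 = n + 1 by push_cast; ring]
    push_cast
    linarith
  | one =>
    have h := aux_step ((n : ℝ) + 1 / 2) (by positivity)
    have h2 := aux_log n hn (1 / 2) (by norm_num)
    rw [show (1 : ℝ) / 2 / n = 1 / 2 * (1 / n) by field_simp] at h2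
    rw [show (n : ℝ) + (((1 : ℕ) : ℝ) + 2) / 2 = n + 1 / 2 + 1 by push_cast; ring, h]
    push_cast
    linarith
  | more k ih _ =>
    have h := aux_step ((n : ℝ) + ((k : ℝ) + 2) / 2) (by positivity)
    have h2 := aux_log n hn (((k : ℝ) + 2) / 2) (by positivity)
    rw [div_eq_mul_one_div _ (n : ℝ)] at h2
    rw [show (n : ℝ) + (((k + 2 : ℕ) : ℝ) + 2) / 2 = n + ((k : ℝ) + 2) / 2 + 1 by
      push_cast; ring, h]
    push_cast
    have hk : 0 ≤ (k : ℝ) * (1 / n) := by positivity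
    nlinarith

/-- For all integers `m ≥ 1` and `n ≥ 4`,
`m·log( Γ(n + m/2)·Γ(1/2) / ( Γ(m/2)·Γ(n + 1/2) ) )
  ≤ (m(m−1)/2)·log n + max{ 0, log m − m·( log( Γ(m/2)/Γ(1/2) ) − m(m−1)/(4n) + 1/(12n) ) }`. -/
theorem stmt_7 (m n : ℕ) (hm : 1 ≤ m) (hn : 4 ≤ n) :
    (m : ℝ) * Real.log
        (Real.Gamma ((n : ℝ) + (m : ℝ) / 2) * Real.Gamma (1 / 2) /
          (Real.Gamma ((m : ℝ) / 2) * Real.Gamma ((n : ℝ) + 1 / 2)))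
      ≤ (m : ℝ) * ((m : ℝ) - 1) / 2 * Real.log n +
        max 0 (Real.log m -
          (m : ℝ) * (Real.log (Real.Gamma ((m : ℝ) / 2) / Real.Gamma (1 / 2)) -
            (m : ℝ) * ((m : ℝ) - 1) / (4 * n) + 1 / (12 * n))) := by
  have hn0 : (0 : ℝ) < n := by exact_mod_cast (by omega : 0 < n)
  have hm0 : (0 : ℝ) < m := by exact_mod_cast hm
  rcases Nat.lt_or_ge m 2 with h | h
  · obtain rfl : m = 1 := by omega
    have g1 := (Real.Gamma_pos_of_pos (show (0 : ℝ) < 1 / 2 by norm_num)).ne'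
    have g2 := (Real.Gamma_pos_of_pos (show (0 : ℝ) < n + 1 / 2 by positivity)).ne'
    have e : Real.Gamma ((n : ℝ) + ((1 : ℕ) : ℝ) / 2) * Real.Gamma (1 / 2) /
          (Real.Gamma (((1 : ℕ) : ℝ) / 2) * Real.Gamma ((n : ℝ) + 1 / 2)) = 1 := by
      rw [Nat.cast_one, mul_comm]
      exact div_self (mul_ne_zero g1 g2)
    rw [e, Real.log_one, mul_zero]
    have : (((1 : ℕ) : ℝ)) * (((1 : ℕ) : ℝ) - 1) / 2 * Real.log n = 0 := by simp
    rw [this, zero_add]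
    exact le_max_left _ _
  · obtain ⟨k, rfl⟩ := Nat.exists_eq_add_of_le' h
    have hk := aux_main n hn k
    have g1 := (Real.Gamma_pos_of_pos (show (0 : ℝ) < 1 / 2 by norm_num)).ne'
    have g2 := (Real.Gamma_pos_of_pos (show (0 : ℝ) < n + 1 / 2 by positivity)).ne'
    have g3 := (Real.Gamma_pos_of_pos (show (0 : ℝ) < n + ((k + 2 : ℕ) : ℝ) / 2 by positivity)).ne'
    have g4 := (Real.Gamma_pos_of_pos (show (0 : ℝ) < ((k + 2 : ℕ) : ℝ) / 2 by positivity)).ne'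
    refine le_trans ?_ (add_le_add_right (le_max_right _ _) _)
    rw [Real.log_div (mul_ne_zero g3 g1) (mul_ne_zero g4 g2), Real.log_mul g3 g1,
      Real.log_mul g4 g2, Real.log_div g4 g1]
    have hl : 0 ≤ Real.log ((k + 2 : ℕ) : ℝ) := Real.log_natCast_nonneg _
    have hk2 := mul_le_mul_of_nonneg_left hk hm0.le
    have e1 : ((k + 2 : ℕ) : ℝ) * (((k + 2 : ℕ) : ℝ) - 1) / (4 * n) =
      ((k : ℝ) + 2) * (k + 1) / 4 * (1 / n) := by push_cast; field_simp; ring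
    have e2 : (1 : ℝ) / (12 * n) = 1 / 12 * (1 / n) := by field_simp
    rw [e1, e2]
    push_cast at hk2 hl ⊢
    linarith
end

section
/- Let m ≥ 1 and let n_1, …, n_m be nonnegative integers with Σ_j n_j = N ≥ 1. Then the ratio of the maximized multinomial probability to the Krichevsky–Trofimov mixture satisfies ( ∏_{j=1}^m (n_j/N)^{n_j} ) / ( Γ(m/2)·∏_{j=1}^m Γ(n_j + 1/2) / ( Γ(1/2)^m · Γ(N + m/2) ) ) ≤ Γ(N + m/2)·Γ(1/2) / ( Γ(m/2)·Γ(N + 1/2) ), with the convention 0^0 = 1. -/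
open Real

noncomputable def ktH (x : ℝ) : ℝ := (x + 1) * Real.log (x + 1) - x * Real.log x - Real.log (x + 1 / 2)

lemma ktH_mono : MonotoneOn ktH (Set.Ici 0) := by
  apply monotoneOn_of_hasDerivWithinAt_nonneg (convex_Ici 0)
    (f' := fun x => Real.log (x + 1) - Real.log x - 1 / (x + 1 / 2))
  · unfold ktH
    apply ContinuousOn.sub
    · apply Continuous.continuousOn
      exact (Real.continuous_mul_log.comp (continuous_id.add continuous_const)).sub
        Real.continuous_mul_log
    · apply ContinuousOn.log
      · fun_prop
      · intro x hx
        have : (0 : ℝ) ≤ x := hx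
        positivity
  · intro x hx
    rw [interior_Ici] at hx
    have hx : (0 : ℝ) < x := hx
    apply HasDerivAt.hasDerivWithinAt
    have h1 : HasDerivAt (fun x : ℝ => (x + 1) * Real.log (x + 1)) (Real.log (x + 1) + 1) x := by
      have := (Real.hasDerivAt_mul_log (x := x + 1) (by positivity)).comp_add_const x 1
      exact this
    have h2 := Real.hasDerivAt_mul_log (x := x) hx.ne'
    have h3 : HasDerivAt (fun x : ℝ => Real.log (x + 1 / 2)) (1 / (x + 1 / 2)) x :=
      ((hasDerivAt_id x).add_const (1 / 2 : ℝ)).log (by simp only [id]; positivity)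
    have := (h1.sub h2).sub h3
    convert this using 1
    · rfl
    · ring
  · intro x hx
    rw [interior_Ici] at hx
    have hx : (0 : ℝ) < x := hx
    have h := Real.le_log_one_add_of_nonneg (x := 1 / x) (by positivity)
    have e1 : 1 + 1 / x = (x + 1) / x := by field_simp
    have e2 : 2 * (1 / x) / (1 / x + 2) = 1 / (x + 1 / 2) := by
      field_simp
      ring
    rw [e1, e2, Real.log_div (by positivity) hx.ne'] at h
    linarith

noncomputable def ktf (n : ℕ) : ℝ := (n : ℝ) ^ n * Real.Gamma (1 / 2) / Real.Gamma ((n : ℝ) + 1 / 2)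

lemma ktGamma_pos (n : ℕ) : 0 < Real.Gamma ((n : ℝ) + 1 / 2) := Real.Gamma_pos_of_pos (by positivity)

lemma ktHalf_pos : 0 < Real.Gamma (1 / 2) := Real.Gamma_pos_of_pos (by positivity)

lemma ktpow_pos (n : ℕ) : 0 < (n : ℝ) ^ n := by
  rcases Nat.eq_zero_or_pos n with h | h
  · simp [h]
  · positivity

lemma ktf_pos (n : ℕ) : 0 < ktf n :=
  div_pos (mul_pos (ktpow_pos n) ktHalf_pos) (ktGamma_pos n)

lemma ktf_zero : ktf 0 = 1 := by
  have := ktHalf_pos.ne'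
  unfold ktf
  rw [Nat.cast_zero, zero_add, pow_zero, one_mul, div_self this]

lemma ktf_log (n : ℕ) : Real.log (ktf n) =
    n * Real.log n + Real.log (Real.Gamma (1 / 2)) - Real.log (Real.Gamma ((n : ℝ) + 1 / 2)) := by
  unfold ktf
  rw [Real.log_div (mul_pos (ktpow_pos n) ktHalf_pos).ne' (ktGamma_pos n).ne',
    Real.log_mul (ktpow_pos n).ne' ktHalf_pos.ne', Real.log_pow]

lemma ktf_succ (n : ℕ) : Real.log (ktf (n + 1)) = Real.log (ktf n) + ktH n := by
  rw [ktf_log, ktf_log]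
  have e : ((n + 1 : ℕ) : ℝ) + 1 / 2 = ((n : ℝ) + 1 / 2) + 1 := by push_cast; ring
  have hp : (0 : ℝ) < (n : ℝ) + 1 / 2 := by positivity
  rw [e, Real.Gamma_add_one hp.ne', Real.log_mul hp.ne' (ktGamma_pos n).ne']
  unfold ktH
  push_cast
  ring

lemma ktf_add_log (a b : ℕ) : Real.log (ktf a) + Real.log (ktf b) ≤ Real.log (ktf (a + b)) := by
  induction b with
  | zero => simp [ktf_zero]
  | succ b ih =>
    rw [← add_assoc, ktf_succ, ktf_succ]
    have : ktH (b : ℝ) ≤ ktH ((a + b : ℕ) : ℝ) := by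
      apply ktH_mono
      · exact Set.mem_Ici.mpr (by positivity)
      · exact Set.mem_Ici.mpr (by positivity)
      · push_cast
        linarith [Nat.cast_nonneg (α := ℝ) a]
    linarith

lemma ktf_mul_le (a b : ℕ) : ktf a * ktf b ≤ ktf (a + b) := by
  rw [← Real.log_le_log_iff (mul_pos (ktf_pos a) (ktf_pos b)) (ktf_pos _),
    Real.log_mul (ktf_pos a).ne' (ktf_pos b).ne']
  exact ktf_add_log a b

lemma ktf_prod_le {ι : Type*} (s : Finset ι) (n : ι → ℕ) :
    ∏ j ∈ s, ktf (n j) ≤ ktf (∑ j ∈ s, n j) := by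
  classical
  induction s using Finset.induction_on with
  | empty => simp [ktf_zero]
  | insert a s ha ih =>
    rw [Finset.prod_insert ha, Finset.sum_insert ha]
    exact (mul_le_mul_of_nonneg_left ih (ktf_pos _).le).trans (ktf_mul_le _ _)

/-- The ratio of the maximized multinomial probability to the Krichevsky–Trofimov mixture
satisfies
`( ∏ (n_j/N)^{n_j} ) / ( Γ(m/2)·∏ Γ(n_j+1/2) / ( Γ(1/2)^m·Γ(N+m/2) ) )
  ≤ Γ(N+m/2)·Γ(1/2) / ( Γ(m/2)·Γ(N+1/2) )` (convention `0^0 = 1`, automatic for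
natural-number exponents). -/
theorem stmt_10 (m : ℕ) (hm : 1 ≤ m) (n : Fin m → ℕ) (N : ℕ)
    (hN : ∑ j, n j = N) (hN1 : 1 ≤ N) :
    (∏ j, ((n j : ℝ) / (N : ℝ)) ^ (n j)) /
        (Real.Gamma ((m : ℝ) / 2) * (∏ j, Real.Gamma ((n j : ℝ) + 1 / 2)) /
          (Real.Gamma (1 / 2) ^ m * Real.Gamma ((N : ℝ) + (m : ℝ) / 2)))
      ≤ Real.Gamma ((N : ℝ) + (m : ℝ) / 2) * Real.Gamma (1 / 2) /
          (Real.Gamma ((m : ℝ) / 2) * Real.Gamma ((N : ℝ) + 1 / 2)) := by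
  have hN0 : (0 : ℝ) < N := by exact_mod_cast hN1
  have key := ktf_prod_le Finset.univ n
  rw [hN] at key
  unfold ktf at key
  rw [Finset.prod_div_distrib, Finset.prod_mul_distrib, Finset.prod_const, Finset.card_univ,
    Fintype.card_fin] at key
  have e : ∏ j, ((n j : ℝ) / (N : ℝ)) ^ (n j) = (∏ j, (n j : ℝ) ^ (n j)) / (N : ℝ) ^ N := by
    simp_rw [div_pow]
    rw [Finset.prod_div_distrib, Finset.prod_pow_eq_pow_sum, hN]
  rw [e]
  have hP : 0 < ∏ j, Real.Gamma ((n j : ℝ) + 1 / 2) := Finset.prod_pos fun j _ => ktGamma_pos _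
  have hm0 : (0 : ℝ) < m := by exact_mod_cast hm
  have hA : 0 < Real.Gamma ((m : ℝ) / 2) := Real.Gamma_pos_of_pos (by positivity)
  have hB : 0 < Real.Gamma ((N : ℝ) + (m : ℝ) / 2) := Real.Gamma_pos_of_pos (by positivity)
  have hC := ktGamma_pos N
  have hG := ktHalf_pos
  have hQ : (0 : ℝ) < (N : ℝ) ^ N := by positivity
  generalize (∏ j, Real.Gamma ((n j : ℝ) + 1 / 2)) = P at *
  generalize (∏ j, (n j : ℝ) ^ (n j)) = R at *
  generalize Real.Gamma ((m : ℝ) / 2) = A at *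
  generalize Real.Gamma ((N : ℝ) + (m : ℝ) / 2) = B at *
  generalize Real.Gamma ((N : ℝ) + 1 / 2) = C at *
  generalize Real.Gamma (1 / 2) = G at *
  generalize (N : ℝ) ^ N = Q at *
  have h2 := mul_le_mul_of_nonneg_left key (show 0 ≤ B / (A * Q) by positivity)
  calc _ = B / (A * Q) * (R * G ^ m / P) := by field_simp
    _ ≤ _ := h2
    _ = _ := by field_simp
end

section
/- Let m ≥ 1, n ≥ 4, let (n_{ij})_{1≤i,j≤m} be nonnegative integers with Σ_{i,j} n_{ij} ≤ n, set n_i = Σ_j n_{ij}, and let A = [a_{ij}] be any m×m row-stochastic matrix. Then ∏_{i,j} a_{ij}^{n_{ij}} ≤ n^{m(m−1)/2} · e^{c_m(n)} · ∏_{i=1}^m ( Γ(m/2)·∏_{j=1}^m Γ(n_{ij} + 1/2) / ( Γ(1/2)^m · Γ(n_i + m/2) ) ), where c_m(n) = max{ 0, log m − m·( log( Γ(m/2)/Γ(1/2) ) − m(m−1)/(4n) + 1/(12n) ) } and the convention 0^0 = 1 is used. -/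
open Real

lemma kt_g_mono : MonotoneOn (fun x : ℝ => (x+1) * Real.log (x+1) - x * Real.log x - Real.log (x + 1/2))
    (Set.Ici 0) := by
  have hd : ∀ x : ℝ, 0 < x → HasDerivAt (fun x : ℝ => (x+1) * Real.log (x+1) - x * Real.log x - Real.log (x + 1/2))
      ((Real.log (x+1) + 1) - (Real.log x + 1) - 1 / (x+1/2)) x := by
    intro x hx
    have h1 : HasDerivAt (fun x : ℝ => (x+1) * Real.log (x+1)) (Real.log (x+1) + 1) x := by
      have := (Real.hasDerivAt_mul_log (x := x+1) (by positivity)).comp_add_const x 1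
      simpa using this
    have h2 := Real.hasDerivAt_mul_log (x := x) hx.ne'
    have h3 : HasDerivAt (fun x : ℝ => Real.log (x + 1/2)) (1 / (x+1/2)) x :=
      ((hasDerivAt_id x).add_const (1/2)).log (by simp only [id]; positivity)
    exact (h1.sub h2).sub h3
  apply monotoneOn_of_deriv_nonneg (convex_Ici 0)
  · apply ContinuousOn.sub
    · apply Continuous.continuousOn
      exact (Real.continuous_mul_log.comp (continuous_id.add continuous_const)).sub Real.continuous_mul_log
    · apply ContinuousOn.log
      · fun_prop
      · intro x hx
        have : (0:ℝ) ≤ x := hx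
        positivity
  · intro x hx
    rw [interior_Ici] at hx
    exact (hd x hx).differentiableAt.differentiableWithinAt
  · intro x hx
    rw [interior_Ici] at hx
    have hx : 0 < x := hx
    rw [(hd x hx).deriv]
    have h := Real.le_log_one_add_of_nonneg (x := 1/x) (by positivity)
    have e1 : 2 * (1/x) / (1/x + 2) = 1 / (x+1/2) := by field_simp; ring
    have e2 : Real.log (1 + 1/x) = Real.log (x+1) - Real.log x := by
      rw [← Real.log_div (by positivity) (by positivity)]
      congr 1
      field_simp
    rw [e1, e2] at h
    linarith

/-- `k^k / (1/2)_k`. -/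
noncomputable def ktF (k : ℕ) : ℝ := (k:ℝ)^k * Real.Gamma (1/2) / Real.Gamma ((k:ℝ) + 1/2)

lemma ktG_pos (k : ℕ) : 0 < Real.Gamma ((k:ℝ) + 1/2) := Real.Gamma_pos_of_pos (by positivity)

lemma kt_h_pos : 0 < Real.Gamma (1/2) := Real.Gamma_pos_of_pos (by positivity)

lemma kt_self_pow_pos (k : ℕ) : 0 < (k:ℝ)^k := by
  rcases Nat.eq_zero_or_pos k with h | h
  · simp [h]
  · positivity

lemma ktF_pos (k : ℕ) : 0 < ktF k :=
  div_pos (mul_pos (kt_self_pow_pos k) kt_h_pos) (ktG_pos k)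

lemma kt_self_pow (k : ℕ) : (k:ℝ)^k = Real.exp (k * Real.log k) := by
  rw [← Real.log_pow, Real.exp_log (kt_self_pow_pos k)]

lemma ktF_succ (k : ℕ) : ktF (k+1) =
    Real.exp (((k:ℝ)+1) * Real.log ((k:ℝ)+1) - k * Real.log k - Real.log ((k:ℝ) + 1/2)) * ktF k := by
  have hk : (0:ℝ) < (k:ℝ) + 1/2 := by positivity
  have hG : Real.Gamma (((k+1:ℕ):ℝ) + 1/2) = ((k:ℝ)+1/2) * Real.Gamma ((k:ℝ)+1/2) := by
    rw [← Real.Gamma_add_one hk.ne']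
    congr 1
    push_cast
    ring
  unfold ktF
  rw [hG, kt_self_pow (k+1), kt_self_pow k, Real.exp_sub, Real.exp_sub, Real.exp_log hk]
  have := ktG_pos k
  have := Real.exp_pos (k * Real.log k)
  push_cast
  field_simp

lemma ktF_super (a b : ℕ) : ktF a * ktF b ≤ ktF (a+b) := by
  induction a with
  | zero =>
    have : ktF 0 = 1 := by
      unfold ktF
      have := kt_h_pos.ne'
      simp only [Nat.cast_zero, pow_zero, zero_add, one_mul]
      exact div_self this
    simp [this]
  | succ a ih =>
    rw [ktF_succ, show a + 1 + b = (a + b) + 1 by ring, ktF_succ, mul_assoc]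
    apply mul_le_mul _ ih (mul_pos (ktF_pos _) (ktF_pos _)).le (Real.exp_pos _).le
    apply Real.exp_le_exp.mpr
    have := kt_g_mono (a := (a:ℝ)) (b := ((a+b:ℕ):ℝ)) (by simp) (Set.mem_Ici.mpr (Nat.cast_nonneg _))
      (by push_cast; linarith [Nat.cast_nonneg (α := ℝ) b])
    exact this

lemma ktF_prod {ι : Type*} (s : Finset ι) (k : ι → ℕ) : ∏ j ∈ s, ktF (k j) ≤ ktF (∑ j ∈ s, k j) := by
  classical
  induction s using Finset.induction_on with
  | empty =>
    unfold ktF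
    have := kt_h_pos.ne'
    simp only [Finset.sum_empty, Finset.prod_empty, Nat.cast_zero, pow_zero, zero_add, one_mul]
    exact (div_self this).ge
  | insert a s ha ih =>
    rw [Finset.prod_insert ha, Finset.sum_insert ha]
    exact (mul_le_mul_of_nonneg_left ih (ktF_pos _).le).trans (ktF_super _ _)

lemma kt_gibbs {m : ℕ} (k : Fin m → ℕ) (a : Fin m → ℝ) (h0 : ∀ j, 0 ≤ a j) (h1 : ∑ j, a j = 1)
    (N : ℕ) (hN : N = ∑ j, k j) :
    (∏ j, a j ^ k j) * (N:ℝ)^N ≤ ∏ j, ((k j : ℝ) ^ k j) := by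
  rcases Nat.eq_zero_or_pos N with h | h
  · have : ∀ j, k j = 0 := by
      intro j
      have := Finset.single_le_sum (f := k) (fun i _ => Nat.zero_le _) (Finset.mem_univ j)
      omega
    simp [this, h]
  · have hNr : (0:ℝ) < N := by exact_mod_cast h
    have hs : ∑ j, (k j : ℝ) = N := by rw [hN]; push_cast; rfl
    have key := Real.geom_mean_le_arith_mean Finset.univ (fun j => (k j : ℝ)) (fun j => a j / k j)
      (fun i _ => Nat.cast_nonneg _) (by rw [hs]; exact hNr)
      (fun i _ => div_nonneg (h0 i) (Nat.cast_nonneg _))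
    simp only [hs, Real.rpow_natCast] at key
    have hP : 0 ≤ ∏ j, (a j / k j) ^ k j :=
      Finset.prod_nonneg fun i _ => pow_nonneg (div_nonneg (h0 i) (Nat.cast_nonneg _)) _
    have hle : ∑ j, (k j : ℝ) * (a j / k j) ≤ 1 := by
      rw [← h1]
      apply Finset.sum_le_sum
      intro j _
      rcases Nat.eq_zero_or_pos (k j) with hk | hk
      · simp [hk, h0 j]
      · have : (0:ℝ) < k j := by exact_mod_cast hk
        exact (mul_div_cancel₀ _ this.ne').le
    have key2 : (∏ j, (a j / k j) ^ k j) ^ ((N:ℝ)⁻¹) ≤ 1 / N :=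
      key.trans (div_le_div_of_nonneg_right hle hNr.le)
    have key3 := pow_le_pow_left₀ (Real.rpow_nonneg hP _) key2 N
    rw [Real.rpow_inv_natCast_pow hP h.ne'] at key3
    simp only [div_pow, Finset.prod_div_distrib, one_pow] at key3
    rw [div_le_div_iff₀ (Finset.prod_pos fun j _ => kt_self_pow_pos _) (kt_self_pow_pos N), one_mul] at key3
    exact key3

lemma kt_row {m : ℕ} (k : Fin m → ℕ) (a : Fin m → ℝ) (h0 : ∀ j, 0 ≤ a j) (h1 : ∑ j, a j = 1)
    (N : ℕ) (hN : N = ∑ j, k j) :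
    (∏ j, a j ^ k j) ≤ Real.Gamma (1/2) * (∏ j, Real.Gamma ((k j : ℝ) + 1/2)) /
      (Real.Gamma (1/2) ^ m * Real.Gamma ((N:ℝ) + 1/2)) := by
  have hg := kt_gibbs k a h0 h1 N hN
  have hf := ktF_prod Finset.univ k
  rw [← hN] at hf
  unfold ktF at hf
  have hh := kt_h_pos
  have hp : 0 < ∏ j, Real.Gamma ((k j : ℝ) + 1/2) := Finset.prod_pos fun j _ => ktG_pos _
  have hNp := kt_self_pow_pos N
  rw [Finset.prod_div_distrib, Finset.prod_mul_distrib, Finset.prod_const, Finset.card_univ, Fintype.card_fin,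
    div_le_div_iff₀ hp (ktG_pos N)] at hf
  rw [le_div_iff₀ (mul_pos (pow_pos hh m) (ktG_pos N))]
  have h2 := mul_le_mul_of_nonneg_right hg (mul_pos (pow_pos hh m) (ktG_pos N)).le
  refine le_of_mul_le_mul_right ?_ hNp
  nlinarith

/-- worst-case row regret -/
noncomputable def ktR (m N : ℕ) : ℝ := Real.Gamma (1/2) * Real.Gamma ((N:ℝ) + (m:ℝ)/2) /
  (Real.Gamma ((m:ℝ)/2) * Real.Gamma ((N:ℝ) + 1/2))

lemma ktR_pos (m N : ℕ) (hm : 1 ≤ m) : 0 < ktR m N := by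
  have : (0:ℝ) < m := by exact_mod_cast hm
  exact div_pos (mul_pos kt_h_pos (Real.Gamma_pos_of_pos (by positivity)))
    (mul_pos (Real.Gamma_pos_of_pos (by positivity)) (ktG_pos N))

lemma ktR_mono (m : ℕ) (hm : 1 ≤ m) : Monotone (ktR m) := by
  apply monotone_nat_of_le_succ
  intro N
  have hmr : (1:ℝ) ≤ m := by exact_mod_cast hm
  have hp := ktR_pos m N hm
  have e : ktR m (N+1) = (((N:ℝ) + m/2) / ((N:ℝ)+1/2)) * ktR m N := by
    unfold ktR
    have a1 : (0:ℝ) < (N:ℝ) + m/2 := by positivity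
    have a2 : (0:ℝ) < (N:ℝ) + 1/2 := by positivity
    have e1 : ((N+1:ℕ):ℝ) + m/2 = ((N:ℝ) + m/2) + 1 := by push_cast; ring
    have e2 : ((N+1:ℕ):ℝ) + 1/2 = ((N:ℝ) + 1/2) + 1 := by push_cast; ring
    rw [e1, e2, Real.Gamma_add_one a1.ne', Real.Gamma_add_one a2.ne', div_mul_div_comm]
    congr 1 <;> ring
  rw [e]
  have : 1 ≤ ((N:ℝ) + m/2) / ((N:ℝ)+1/2) := by
    rw [le_div_iff₀ (by positivity)]
    linarith
  nlinarith

lemma kt_gamma_half (n : ℕ) : ∀ k : ℕ,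
    Real.Gamma ((n:ℝ) + 1/2 + (k:ℝ)/2)^2 ≤ Real.Gamma ((n:ℝ)+1/2)^2 * ((n:ℝ) + (k:ℝ)/2)^k
  | 0 => by simp
  | 1 => by
    have hx : (0:ℝ) < (n:ℝ)+1/2 := by positivity
    have h := Real.Gamma_mul_add_mul_le_rpow_Gamma_mul_rpow_Gamma (s := (n:ℝ)+1/2) (t := (n:ℝ)+1/2+1)
      (a := 1/2) (b := 1/2) hx (by positivity) (by norm_num) (by norm_num) (by norm_num)
    have e : (1/2 : ℝ) * ((n:ℝ)+1/2) + 1/2 * ((n:ℝ)+1/2+1) = (n:ℝ) + 1/2 + ((1:ℕ):ℝ)/2 := by push_cast; ring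
    rw [e, Real.Gamma_add_one hx.ne', ← Real.sqrt_eq_rpow, ← Real.sqrt_eq_rpow] at h
    have hg := ktG_pos n
    have h2 := pow_le_pow_left₀ (Real.Gamma_pos_of_pos (by positivity)).le h 2
    rw [mul_pow, Real.sq_sqrt hg.le, Real.sq_sqrt (by positivity)] at h2
    refine h2.trans (le_of_eq ?_)
    push_cast
    ring
  | (k+2) => by
    have ih := kt_gamma_half n k
    have hx : (0:ℝ) < (n:ℝ)+1/2+(k:ℝ)/2 := by positivity
    have e : (n:ℝ) + 1/2 + ((k+2:ℕ):ℝ)/2 = ((n:ℝ)+1/2+(k:ℝ)/2) + 1 := by push_cast; ring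
    rw [e, Real.Gamma_add_one hx.ne', mul_pow]
    have e2 : (n:ℝ) + ((k+2:ℕ):ℝ)/2 = (n:ℝ) + (k:ℝ)/2 + 1 := by push_cast; ring
    rw [e2, pow_add]
    have b1 : ((n:ℝ)+1/2+(k:ℝ)/2)^2 ≤ ((n:ℝ) + (k:ℝ)/2 + 1)^2 :=
      pow_le_pow_left₀ hx.le (by linarith) 2
    have b2 : ((n:ℝ) + (k:ℝ)/2)^k ≤ ((n:ℝ) + (k:ℝ)/2 + 1)^k :=
      pow_le_pow_left₀ (by positivity) (by linarith) k
    calc _ ≤ ((n:ℝ) + (k:ℝ)/2 + 1)^2 * (Real.Gamma ((n:ℝ)+1/2)^2 * ((n:ℝ) + (k:ℝ)/2 + 1)^k) := by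
          gcongr
          exact ih.trans (by gcongr)
      _ = _ := by ring

lemma ktR_log (m n : ℕ) (hm : 1 ≤ m) (hn : 1 ≤ n) :
    Real.log (ktR m n) ≤ - Real.log (Real.Gamma ((m:ℝ)/2) / Real.Gamma (1/2)) +
      ((m:ℝ)-1)/2 * Real.log n + ((m:ℝ)-1)^2/(4*n) := by
  obtain ⟨k, rfl⟩ : ∃ k, m = k+1 := ⟨m-1, by omega⟩
  have hnr : (0:ℝ) < n := by exact_mod_cast hn
  have h := kt_gamma_half n k
  have e : (n:ℝ) + 1/2 + (k:ℝ)/2 = (n:ℝ) + ((k+1:ℕ):ℝ)/2 := by push_cast; ring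
  rw [e] at h
  have p1 : 0 < Real.Gamma ((n:ℝ) + ((k+1:ℕ):ℝ)/2) := Real.Gamma_pos_of_pos (by positivity)
  have p2 : 0 < Real.Gamma (((k+1:ℕ):ℝ)/2) := Real.Gamma_pos_of_pos (by positivity)
  have p3 := ktG_pos n
  have p4 := kt_h_pos
  have p5 : 0 < (n:ℝ) + (k:ℝ)/2 := by positivity
  have hl := Real.log_le_log (by positivity) h
  rw [Real.log_mul (by positivity) (by positivity), Real.log_pow, Real.log_pow, Real.log_pow] at hl
  have hlog : Real.log ((n:ℝ) + (k:ℝ)/2) ≤ Real.log n + (k:ℝ)/2/n := by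
    have e3 : (n:ℝ) + (k:ℝ)/2 = n * (1 + (k:ℝ)/2/n) := by field_simp
    rw [e3, Real.log_mul (by positivity) (by positivity)]
    have := Real.log_le_sub_one_of_pos (x := 1 + (k:ℝ)/2/n) (by positivity)
    linarith
  have hk := mul_le_mul_of_nonneg_left hlog (Nat.cast_nonneg (α := ℝ) k)
  unfold ktR
  rw [Real.log_div (by positivity) (by positivity), Real.log_mul (by positivity) (by positivity),
    Real.log_mul (by positivity) (by positivity), Real.log_div (by positivity) (by positivity)]
  have e4 : (((k+1:ℕ):ℝ)-1)^2/(4*n) = (k:ℝ) * ((k:ℝ)/2/n) / 2 := by push_cast; field_simp; ring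
  rw [e4]
  push_cast at *
  nlinarith

lemma ktR_pow (m n : ℕ) (hm : 1 ≤ m) (hn : 1 ≤ n) :
    ktR m n ^ m ≤ (n : ℝ) ^ (m * (m - 1) / 2) *
          Real.exp (max 0 (Real.log m -
            (m : ℝ) * (Real.log (Real.Gamma ((m : ℝ) / 2) / Real.Gamma (1 / 2)) -
              (m : ℝ) * ((m : ℝ) - 1) / (4 * n) + 1 / (12 * n)))) := by
  rcases hm.eq_or_lt with h | h
  · subst h
    have : ktR 1 n = 1 := by
      unfold ktR
      rw [Nat.cast_one]
      exact div_self (mul_pos kt_h_pos (ktG_pos n)).ne'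
    rw [this]
    simp
  · have hnr : (0:ℝ) < n := by exact_mod_cast hn
    have hmr : (2:ℝ) ≤ m := by exact_mod_cast h
    have hpow : (n : ℝ) ^ (m * (m - 1) / 2) = Real.exp (((m:ℝ) * ((m:ℝ)-1)/2) * Real.log n) := by
      have e : ((m * (m-1) / 2 : ℕ):ℝ) = (m:ℝ) * ((m:ℝ)-1)/2 := by
        rw [Nat.cast_div (Nat.even_mul_pred_self m).two_dvd (by norm_num)]
        push_cast [Nat.cast_sub hm]
        ring
      rw [← e, ← Real.log_pow, Real.exp_log (by positivity)]
    rw [hpow, ← Real.exp_add, ← Real.exp_log (ktR_pos m n hm), ← Real.exp_nat_mul]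
    apply Real.exp_le_exp.mpr
    have hR := mul_le_mul_of_nonneg_left (ktR_log m n hm hn) (Nat.cast_nonneg (α := ℝ) m)
    refine hR.trans ?_
    refine le_trans ?_ (add_le_add_right (le_max_right _ _) _)
    have hlm : 0 ≤ Real.log m := Real.log_nonneg (by linarith)
    have hc : ((m:ℝ)-1)^2/(4*n) ≤ (m : ℝ) * ((m : ℝ) - 1) / (4 * n) - 1 / (12 * n) := by
      have e : (m : ℝ) * ((m : ℝ) - 1) / (4 * n) - 1 / (12 * n) = (m * ((m:ℝ)-1) - 1/3)/(4*n) := by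
        field_simp
        ring
      rw [e]
      apply div_le_div_of_nonneg_right _ (by positivity)
      nlinarith
    have hc' := mul_le_mul_of_nonneg_left hc (Nat.cast_nonneg (α := ℝ) m)
    linarith

/-- Bound on a Markov transition-count probability by the row-wise Krichevsky–Trofimov
mixture: for any `m×m` row-stochastic matrix `A` and nonnegative transition counts
`n_{ij}` with `Σ_{ij} n_{ij} ≤ n`, `n_i = Σ_j n_{ij}`, `n ≥ 4`, `m ≥ 1`,
`∏ a_{ij}^{n_{ij}} ≤ n^{m(m−1)/2} e^{c_m(n)}
  ∏_i ( Γ(m/2) ∏_j Γ(n_{ij}+1/2) / ( Γ(1/2)^m Γ(n_i+m/2) ) )`,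
where `c_m(n) = max{0, log m − m( log(Γ(m/2)/Γ(1/2)) − m(m−1)/(4n) + 1/(12n) )}`.
(The convention `0^0 = 1` is automatic for natural-number exponents.) -/
theorem stmt_11 (m n : ℕ) (hm : 1 ≤ m) (hn : 4 ≤ n)
    (nij : Fin m → Fin m → ℕ) (htot : (∑ i, ∑ j, nij i j) ≤ n)
    (ni : Fin m → ℕ) (hni : ∀ i, ni i = ∑ j, nij i j)
    (A : Fin m → Fin m → ℝ) (hA0 : ∀ i j, 0 ≤ A i j) (hA1 : ∀ i, ∑ j, A i j = 1) :
    (∏ i, ∏ j, (A i j) ^ (nij i j))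
      ≤ (n : ℝ) ^ (m * (m - 1) / 2) *
          Real.exp (max 0 (Real.log m -
            (m : ℝ) * (Real.log (Real.Gamma ((m : ℝ) / 2) / Real.Gamma (1 / 2)) -
              (m : ℝ) * ((m : ℝ) - 1) / (4 * n) + 1 / (12 * n)))) *
          ∏ i, (Real.Gamma ((m : ℝ) / 2) * (∏ j, Real.Gamma ((nij i j : ℝ) + 1 / 2)) /
            (Real.Gamma (1 / 2) ^ m * Real.Gamma ((ni i : ℝ) + (m : ℝ) / 2))) := by
  classical
  have hmr : (0:ℝ) < m := by exact_mod_cast hm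
  have hn1 : 1 ≤ n := by omega
  have pm : 0 < Real.Gamma ((m:ℝ)/2) := Real.Gamma_pos_of_pos (by positivity)
  have ph := kt_h_pos
  have hK : ∀ i, 0 ≤ Real.Gamma ((m : ℝ) / 2) * (∏ j, Real.Gamma ((nij i j : ℝ) + 1 / 2)) /
            (Real.Gamma (1 / 2) ^ m * Real.Gamma ((ni i : ℝ) + (m : ℝ) / 2)) := by
    intro i
    have p1 : 0 < Real.Gamma ((ni i : ℝ) + (m:ℝ)/2) := Real.Gamma_pos_of_pos (by positivity)
    have p2 : 0 < ∏ j, Real.Gamma ((nij i j : ℝ) + 1/2) := Finset.prod_pos fun j _ => ktG_pos _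
    positivity
  have hrow : ∀ i, ∏ j, (A i j) ^ (nij i j) ≤ ktR m n *
      (Real.Gamma ((m : ℝ) / 2) * (∏ j, Real.Gamma ((nij i j : ℝ) + 1 / 2)) /
            (Real.Gamma (1 / 2) ^ m * Real.Gamma ((ni i : ℝ) + (m : ℝ) / 2))) := by
    intro i
    have hin : ni i ≤ n := by
      rw [hni i]
      exact (Finset.single_le_sum (f := fun i => ∑ j, nij i j) (fun _ _ => Nat.zero_le _)
        (Finset.mem_univ i)).trans htot
    refine le_trans ?_ (mul_le_mul_of_nonneg_right (ktR_mono m hm hin) (hK i))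
    refine (kt_row (nij i) (A i) (hA0 i) (hA1 i) (ni i) (hni i)).trans (le_of_eq ?_)
    have p1 : 0 < Real.Gamma ((ni i : ℝ) + (m:ℝ)/2) := Real.Gamma_pos_of_pos (by positivity)
    have p3 := ktG_pos (ni i)
    unfold ktR
    rw [div_mul_div_comm, div_eq_div_iff (by positivity) (by positivity)]
    ring
  calc _ ≤ ∏ i, (ktR m n * (Real.Gamma ((m : ℝ) / 2) * (∏ j, Real.Gamma ((nij i j : ℝ) + 1 / 2)) /
            (Real.Gamma (1 / 2) ^ m * Real.Gamma ((ni i : ℝ) + (m : ℝ) / 2)))) :=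
        Finset.prod_le_prod (fun i _ => Finset.prod_nonneg fun j _ => pow_nonneg (hA0 i j) _)
          (fun i _ => hrow i)
    _ = ktR m n ^ m * _ := by
        rw [Finset.prod_mul_distrib, Finset.prod_const, Finset.card_univ, Fintype.card_fin]
    _ ≤ _ := mul_le_mul_of_nonneg_right (ktR_pow m n hm hn1) (Finset.prod_nonneg fun i _ => hK i)
end

section
/- Let k ≥ 1, let W be a real k×2 matrix, Y ∈ ℝ^k, τ > 0, u₀ > 0, v₀ > 0. Set M = (WᵗW + τ^{−2}I)^{−1} and P = I − W M Wᵗ. Then the integral ∫_0^∞ ∫_{ℝ²} (2πs)^{−k/2}·exp( −‖Y − Wθ‖²/(2s) ) · (2πsτ²)^{−1}·exp( −‖θ‖²/(2sτ²) ) · ( (u₀/2)^{v₀/2}/Γ(v₀/2) )·s^{−(v₀/2+1)}·exp( −u₀/(2s) ) dθ ds equals ( √det(M) / ( (2π)^{k/2}·τ² ) ) · ( (u₀/2)^{v₀/2}·2^{(v₀+k)/2} / Γ(v₀/2) ) · ( YᵗPY + u₀ )^{−(v₀+k)/2} · Γ( (v₀+k)/2 ). -/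
open Matrix MeasureTheory Real

lemma invgamma_aux (r B : ℝ) (hr : 0 < r) (hB : 0 < B) :
    ∫ s in Set.Ioi (0:ℝ), s ^ (-(r+1)) * Real.exp (-B / s) = B ^ (-r) * Real.Gamma r := by
  have h1 := integral_rpow_mul_exp_neg_mul_Ioi hr hB
  have h2 := integral_comp_rpow_Ioi (fun y : ℝ => y ^ (r-1) * Real.exp (-(B*y))) (p := -1) (by norm_num)
  rw [h1] at h2
  rw [one_div, Real.inv_rpow hB.le, ← Real.rpow_neg hB.le] at h2
  rw [← h2]
  refine setIntegral_congr_fun measurableSet_Ioi ?_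
  intro s hs
  have hs : 0 < s := hs
  simp only [smul_eq_mul]
  rw [← Real.rpow_mul hs.le, Real.rpow_neg_one s, ← mul_assoc]
  congr 1
  · rw [abs_neg, abs_one, one_mul, ← Real.rpow_add hs]
    congr 1; ring
  · congr 1; rw [neg_div]; rfl

lemma gauss2_aux (a b c s m0 m1 : ℝ) (ha : 0 < a) (hD : 0 < a * c - b ^ 2) (hs : 0 < s) :
    ∫ θ : Fin 2 → ℝ, Real.exp (-(a * (θ 0 - m0) ^ 2 + 2 * b * (θ 0 - m0) * (θ 1 - m1)
      + c * (θ 1 - m1) ^ 2) / (2 * s)) = 2 * π * s / √(a * c - b ^ 2) := by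
  have h0 := integral_sub_right_eq_self (μ := (volume : Measure (Fin 2 → ℝ)))
    (fun θ : Fin 2 → ℝ => Real.exp (-(a * (θ 0) ^ 2 + 2 * b * (θ 0) * (θ 1)
      + c * (θ 1) ^ 2) / (2 * s))) ![m0, m1]
  simp only [Pi.sub_apply, Matrix.cons_val_zero, Matrix.cons_val_one] at h0
  rw [h0]
  set D := a * c - b ^ 2 with hDdef
  let T : Matrix (Fin 2) (Fin 2) ℝ := !![√a, b / √a; 0, √(D / a)]
  have hT : T.det = √D := by
    simp only [T, Matrix.det_fin_two_of]
    rw [mul_zero, sub_zero, ← Real.sqrt_mul ha.le]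
    congr 1; field_simp
  have hsD : 0 < √D := Real.sqrt_pos.mpr hD
  have hT0 : T.det ≠ 0 := by rw [hT]; exact hsD.ne'
  have hmap := Real.map_matrix_volume_pi_eq_smul_volume_pi hT0
  let g : (Fin 2 → ℝ) → ℝ := fun x => ∏ i, Real.exp (-(1/(2*s)) * (x i) ^ 2)
  have hg : ∫ x, g x = 2 * π * s := by
    have := integral_fintype_prod_volume_eq_prod (𝕜 := ℝ) (ι := Fin 2) (E := fun _ => ℝ) (fun _ x => Real.exp (-(1/(2*s)) * x ^ 2))
    simp only [g]
    rw [this]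
    simp only [integral_gaussian, Fin.prod_univ_two]
    rw [Real.mul_self_sqrt (by positivity)]
    field_simp
  have hcont : Continuous (Matrix.toLin' T) := LinearMap.continuous_of_finiteDimensional _
  have hgc : Continuous g := by fun_prop
  have h3 := integral_map (μ := (volume : Measure (Fin 2 → ℝ))) hcont.aemeasurable
    (f := g) hgc.aestronglyMeasurable
  rw [hmap, integral_smul_measure, hg, hT, abs_of_pos (by positivity),
    ENNReal.toReal_ofReal (by positivity)] at h3
  rw [smul_eq_mul] at h3
  rw [div_eq_inv_mul, h3]
  congr 1; ext x
  simp only [g, Fin.prod_univ_two, ← Real.exp_add]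
  congr 1
  have e1 : √a ^ 2 = a := Real.sq_sqrt ha.le
  have e2 : √(D / a) ^ 2 = D / a := Real.sq_sqrt (by positivity)
  have e3 : √a ≠ 0 := (Real.sqrt_pos.mpr ha).ne'
  have k0 : (Matrix.toLin' T x) 0 = √a * x 0 + b / √a * x 1 := by
    simp [T, Matrix.mulVec, dotProduct, Fin.sum_univ_two]
  have k1 : (Matrix.toLin' T x) 1 = √(D / a) * x 1 := by
    simp [T, Matrix.mulVec, dotProduct, Fin.sum_univ_two]
  rw [k0, k1]
  have q0 : (√a * x 0 + b / √a * x 1)^2 = a * x 0 ^2 + 2 * b * x 0 * x 1 + b^2/a * x 1^2 := by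
    have e4 : (b / √a) ^ 2 = b ^ 2 / a := by rw [div_pow, e1]
    have e5 : √a * (b / √a) = b := by field_simp
    linear_combination x 0 ^ 2 * e1 + x 1 ^ 2 * e4 + 2 * x 0 * x 1 * e5
  rw [q0, mul_pow, e2, hDdef]
  field_simp
  ring

lemma quad_aux (a b c h0 h1 x y Q D: ℝ) (hDD : D = a*c-b^2) (hD : D ≠ 0)  :
  Q - 2*x*h0 - 2*y*h1 + a*x^2+2*b*x*y+c*y^2 =
   (a * (x - (c*h0-b*h1)/D) ^ 2 + 2 * b * (x - (c*h0-b*h1)/D) * (y - (a*h1-b*h0)/D)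
      + c * (y - (a*h1-b*h0)/D) ^ 2) + (Q - (c*h0^2-2*b*h0*h1+a*h1^2)/D) := by
  field_simp
  rw [hDD]
  ring

theorem stmt_13 (k : ℕ) (hk : 1 ≤ k) (W : Matrix (Fin k) (Fin 2) ℝ) (Y : Fin k → ℝ)
    (τ u0 v0 : ℝ) (hτ : 0 < τ) (hu0 : 0 < u0) (hv0 : 0 < v0)
    (M : Matrix (Fin 2) (Fin 2) ℝ) (hM : M = (Wᵀ * W + (τ ^ 2)⁻¹ • 1)⁻¹)
    (P : Matrix (Fin k) (Fin k) ℝ) (hP : P = 1 - W * M * Wᵀ) :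
    (∫ s in Set.Ioi (0 : ℝ), (∫ θ : Fin 2 → ℝ,
        (2 * Real.pi * s) ^ (-(k : ℝ) / 2) *
            Real.exp (-(∑ i, (Y i - W.mulVec θ i) ^ 2) / (2 * s)) *
          ((2 * Real.pi * s * τ ^ 2)⁻¹ * Real.exp (-(∑ j, (θ j) ^ 2) / (2 * s * τ ^ 2))) *
          ((u0 / 2) ^ (v0 / 2) / Real.Gamma (v0 / 2) * s ^ (-(v0 / 2 + 1)) *
            Real.exp (-u0 / (2 * s)))))
      = Real.sqrt M.det / ((2 * Real.pi) ^ ((k : ℝ) / 2) * τ ^ 2) *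
          ((u0 / 2) ^ (v0 / 2) * 2 ^ ((v0 + (k : ℝ)) / 2) / Real.Gamma (v0 / 2)) *
          (Y ⬝ᵥ P.mulVec Y + u0) ^ (-((v0 + (k : ℝ)) / 2)) *
          Real.Gamma ((v0 + (k : ℝ)) / 2) := by
  obtain ⟨p, hp⟩ : ∃ p, p = ∑ i, W i 0 ^ 2 := ⟨_, rfl⟩
  obtain ⟨q, hq⟩ : ∃ p, p = ∑ i, W i 1 ^ 2 := ⟨_, rfl⟩
  obtain ⟨b, hb⟩ : ∃ p, p = ∑ i, W i 0 * W i 1 := ⟨_, rfl⟩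
  obtain ⟨h0, hh0⟩ : ∃ p, p = ∑ i, W i 0 * Y i := ⟨_, rfl⟩
  obtain ⟨h1, hh1⟩ : ∃ p, p = ∑ i, W i 1 * Y i := ⟨_, rfl⟩
  obtain ⟨Q, hQ⟩ : ∃ p, p = ∑ i, Y i ^ 2 := ⟨_, rfl⟩
  obtain ⟨t, ht⟩ : ∃ t, t = (τ ^ 2)⁻¹ := ⟨_, rfl⟩
  have htpos : 0 < t := by rw [ht]; positivity
  have hp0 : 0 ≤ p := by rw [hp]; positivity
  have hq0 : 0 ≤ q := by rw [hq]; positivity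
  have hcs : b ^ 2 ≤ p * q := by
    rw [hb, hp, hq]; exact Finset.sum_mul_sq_le_sq_mul_sq _ _ _
  obtain ⟨a, ha⟩ : ∃ a, a = p + t := ⟨_, rfl⟩
  obtain ⟨c, hc⟩ : ∃ a, a = q + t := ⟨_, rfl⟩
  have ha0 : 0 < a := by linarith
  obtain ⟨D, hDdef⟩ : ∃ D, D = a * c - b ^ 2 := ⟨_, rfl⟩
  have hD : 0 < D := by
    rw [hDdef, ha, hc]; nlinarith [mul_nonneg hp0 htpos.le, mul_nonneg hq0 htpos.le, mul_pos htpos htpos]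
  have hA : Wᵀ * W + (τ ^ 2)⁻¹ • 1 = !![a, b; b, c] := by
    ext i j
    fin_cases i <;> fin_cases j <;>
      simp [Matrix.mul_apply, ha, hc, hb, hp, hq, ht, pow_two, mul_comm]
  have hM2 : M = !![c / D, -b / D; -b / D, a / D] := by
    rw [hM, hA]
    apply Matrix.inv_eq_right_inv
    ext i j
    fin_cases i <;> fin_cases j <;>
      simp [Matrix.mul_apply, Fin.sum_univ_two] <;> field_simp <;> rw [hDdef] <;> ring
  have hdet : M.det = D⁻¹ := by
    rw [hM2, Matrix.det_fin_two_of]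
    field_simp; rw [hDdef]; ring
  have hWY : Wᵀ *ᵥ Y = ![h0, h1] := by
    ext i; fin_cases i <;> simp [Matrix.mulVec, dotProduct, hh0, hh1]
  have hYP : Y ⬝ᵥ P.mulVec Y = Q - (c*h0^2-2*b*h0*h1+a*h1^2)/D := by
    rw [hP, Matrix.sub_mulVec, Matrix.one_mulVec, dotProduct_sub, ← Matrix.mulVec_mulVec,
      ← Matrix.mulVec_mulVec, hWY, Matrix.dotProduct_mulVec, ← Matrix.mulVec_transpose, hWY, hM2]
    have : Y ⬝ᵥ Y = Q := by rw [hQ]; simp [dotProduct, pow_two]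
    rw [this]
    simp [Matrix.mulVec, dotProduct, Fin.sum_univ_two]
    field_simp; ring
  obtain ⟨R, hR⟩ : ∃ R, R = Y ⬝ᵥ P.mulVec Y := ⟨_, rfl⟩
  have hsum : ∀ θ : Fin 2 → ℝ, (∑ i, (Y i - W.mulVec θ i) ^ 2) + t * (∑ j, (θ j) ^ 2) =
      (a * (θ 0 - (c*h0-b*h1)/D) ^ 2 + 2 * b * (θ 0 - (c*h0-b*h1)/D) * (θ 1 - (a*h1-b*h0)/D)
      + c * (θ 1 - (a*h1-b*h0)/D) ^ 2) + R := by
    intro θ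
    rw [hR, hYP, ← quad_aux a b c h0 h1 (θ 0) (θ 1) Q D hDdef hD.ne']
    have : ∑ i, (Y i - W.mulVec θ i) ^ 2 = Q - 2*θ 0*h0 - 2*θ 1*h1 + p*θ 0^2+2*b*θ 0*θ 1+q*θ 1^2 := by
      rw [hQ, hh0, hh1, hp, hq, hb]
      simp only [Finset.mul_sum, Finset.sum_mul, ← Finset.sum_add_distrib, ← Finset.sum_sub_distrib]
      refine Finset.sum_congr rfl fun i _ => ?_
      simp only [Matrix.mulVec, dotProduct, Fin.sum_univ_two]
      ring
    rw [this, Fin.sum_univ_two, ha, hc]; ring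
  have hR0 : 0 ≤ R := by
    have := hsum ![(c*h0-b*h1)/D, (a*h1-b*h0)/D]
    simp only [Matrix.cons_val_zero, Matrix.cons_val_one, sub_self] at this
    have h2 : R = a * 0 ^ 2 + 2 * b * 0 * 0 + c * 0 ^ 2 + R := by ring
    rw [h2, ← this]; positivity
  rw [← hR, hdet]
  have hG : 0 < Real.Gamma (v0/2) := Real.Gamma_pos_of_pos (by positivity)
  have key : ∀ s ∈ Set.Ioi (0:ℝ), (∫ θ : Fin 2 → ℝ,
        (2 * Real.pi * s) ^ (-(k : ℝ) / 2) *
            Real.exp (-(∑ i, (Y i - W.mulVec θ i) ^ 2) / (2 * s)) *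
          ((2 * Real.pi * s * τ ^ 2)⁻¹ * Real.exp (-(∑ j, (θ j) ^ 2) / (2 * s * τ ^ 2))) *
          ((u0 / 2) ^ (v0 / 2) / Real.Gamma (v0 / 2) * s ^ (-(v0 / 2 + 1)) *
            Real.exp (-u0 / (2 * s)))) =
      ((2 * π) ^ (-(k:ℝ)/2) * (τ^2)⁻¹ * (√D)⁻¹ * ((u0 / 2) ^ (v0 / 2) / Real.Gamma (v0 / 2))) *
        (s ^ (-((v0+k)/2+1)) * Real.exp (-((R+u0)/2) / s)) := by
    intro s hs
    have hs : 0 < s := hs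
    have step : ∀ θ : Fin 2 → ℝ, (2 * Real.pi * s) ^ (-(k : ℝ) / 2) *
            Real.exp (-(∑ i, (Y i - W.mulVec θ i) ^ 2) / (2 * s)) *
          ((2 * Real.pi * s * τ ^ 2)⁻¹ * Real.exp (-(∑ j, (θ j) ^ 2) / (2 * s * τ ^ 2))) *
          ((u0 / 2) ^ (v0 / 2) / Real.Gamma (v0 / 2) * s ^ (-(v0 / 2 + 1)) *
            Real.exp (-u0 / (2 * s))) =
        ((2 * Real.pi * s) ^ (-(k : ℝ) / 2) * (2 * Real.pi * s * τ ^ 2)⁻¹ *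
          ((u0 / 2) ^ (v0 / 2) / Real.Gamma (v0 / 2) * s ^ (-(v0 / 2 + 1))) *
            Real.exp (-((R+u0)/2) / s)) *
          Real.exp (-(a * (θ 0 - (c*h0-b*h1)/D) ^ 2 + 2 * b * (θ 0 - (c*h0-b*h1)/D) * (θ 1 - (a*h1-b*h0)/D)
            + c * (θ 1 - (a*h1-b*h0)/D) ^ 2) / (2 * s)) := by
      intro θ
      have e : Real.exp (-(∑ i, (Y i - W.mulVec θ i) ^ 2) / (2 * s)) *
          Real.exp (-(∑ j, (θ j) ^ 2) / (2 * s * τ ^ 2)) * Real.exp (-u0 / (2 * s)) =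
          Real.exp (-((R+u0)/2) / s) * 
          Real.exp (-(a * (θ 0 - (c*h0-b*h1)/D) ^ 2 + 2 * b * (θ 0 - (c*h0-b*h1)/D) * (θ 1 - (a*h1-b*h0)/D)
            + c * (θ 1 - (a*h1-b*h0)/D) ^ 2) / (2 * s)) := by
        simp only [← Real.exp_add]
        congr 1
        have h5 := hsum θ
        rw [ht] at h5
        rw [show -(∑ i, (Y i - W.mulVec θ i) ^ 2) / (2 * s) + -(∑ j, (θ j) ^ 2) / (2 * s * τ ^ 2)
          + -u0 / (2 * s) = -((∑ i, (Y i - W.mulVec θ i) ^ 2) + (τ^2)⁻¹ * (∑ j, (θ j) ^ 2)) / (2 * s)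
            + -u0 / (2*s) by field_simp; ring, h5]
        field_simp
        ring
      rw [mul_assoc _ (Real.exp (-((R+u0)/2) / s)), ← e]
      ring
    simp_rw [step]
    rw [integral_const_mul, gauss2_aux a b c s _ _ ha0 (by rw [← hDdef]; exact hD) hs, ← hDdef,
      Real.mul_rpow (by positivity) hs.le,
      show -((v0+k)/2+1) = -(k:ℝ)/2 + -(v0/2+1) by ring, Real.rpow_add hs]
    have hsD : 0 < √D := Real.sqrt_pos.mpr hD
    field_simp
  rw [setIntegral_congr_fun measurableSet_Ioi key, integral_const_mul,
    invgamma_aux _ _ (by positivity) (by positivity), Real.div_rpow (by positivity : 0 ≤ R + u0) (by norm_num),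
    Real.rpow_neg (by norm_num : (0:ℝ) ≤ 2), neg_div, Real.rpow_neg (by positivity : 0 ≤ 2 * π),
    Real.sqrt_inv]
  field_simp
end
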